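/- Let α > 0, λ ∈ ℝ, t ≥ 0, and let A be the 2 × 2 Jordan block with rows (λ, 1) and (0, λ). Then E_α(t^α A) is the upper-triangular matrix with diagonal entries E_α(λ t^α), E_α(λ t^α) and upper-right entry (t^α / α) · E_{α,α}(λ t^α). -/

import Mathlib

/-- The real one-parameter Mittag-Leffler function `E_α(x) = ∑ x^k / Γ(αk + 1)`. -/
noncomputable def realML (α x : ℝ) : ℝ := ∑' k : ℕ, x ^ k / Real.Gamma (α * k + 1)

/-- The real two-parameter Mittag-Leffler function `E_{α,β}(x) = ∑ x^k / Γ(αk + β)`. -/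
noncomputable def realML2 (α β x : ℝ) : ℝ := ∑' k : ℕ, x ^ k / Real.Gamma (α * k + β)

/-- The matrix Mittag-Leffler function `E_α(B) = ∑ B^k / Γ(αk + 1)`. -/
noncomputable def matrixML {n : ℕ} (α : ℝ) (B : Matrix (Fin n) (Fin n) ℝ) :
    Matrix (Fin n) (Fin n) ℝ :=
  ∑' k : ℕ, (Real.Gamma (α * k + 1))⁻¹ • B ^ k

/-- A lower bound for the Gamma function that beats every geometric growth rate. -/
theorem Real.rpow_mul_exp_neg_le_Gamma_add_one {s M : ℝ} (hs : 0 ≤ s) (hM : 0 ≤ M) :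
    M ^ s * Real.exp (-M) ≤ Real.Gamma (s + 1) := by
  have hint := Real.GammaIntegral_convergent (s := s + 1) (by linarith)
  have hsub : Set.Ioi M ⊆ Set.Ioi 0 := Set.Ioi_subset_Ioi hM
  rw [Real.Gamma_eq_integral (by linarith), ← integral_exp_neg_Ioi M,
    ← MeasureTheory.integral_const_mul]
  calc ∫ x in Set.Ioi M, M ^ s * Real.exp (-x)
      ≤ ∫ x in Set.Ioi M, Real.exp (-x) * x ^ (s + 1 - 1) := by
        refine MeasureTheory.setIntegral_mono_on ((integrableOn_exp_neg_Ioi M).const_mul _)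
          (hint.mono_set hsub) measurableSet_Ioi fun x hx => ?_
        rw [mul_comm, add_sub_cancel_right]
        gcongr
        exact hx.le
    _ ≤ ∫ x in Set.Ioi 0, Real.exp (-x) * x ^ (s + 1 - 1) := by
        refine MeasureTheory.setIntegral_mono_set hint ?_ hsub.eventuallyLE
        filter_upwards [MeasureTheory.ae_restrict_mem measurableSet_Ioi] with x hx
        exact mul_nonneg (Real.exp_pos _).le (Real.rpow_nonneg (Set.mem_Ioi.mp hx).le _)

/-- The two-parameter Mittag-Leffler series converges for all `α, β > 0`. -/
theorem summable_pow_div_Gamma {α β : ℝ} (hα : 0 < α) (hβ : 0 < β) (x : ℝ) :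
    Summable fun k : ℕ => x ^ k / Real.Gamma (α * k + β) := by
  set M : ℝ := (|x| + 1) ^ α⁻¹
  have hx : 0 < |x| + 1 := by positivity
  have hM : 0 < M := Real.rpow_pos_of_pos hx _
  have hMα : M ^ α = |x| + 1 := Real.rpow_inv_rpow hx.le hα.ne'
  set q : ℝ := |x| / (|x| + 1)
  have hq : ‖q‖ < 1 := by
    rw [Real.norm_of_nonneg (by positivity), div_lt_one hx]
    linarith
  have h₀ : Summable fun k : ℕ => q ^ k := summable_geometric_of_norm_lt_one hq
  have h₁ : Summable fun k : ℕ => (k : ℝ) * q ^ k := by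
    simpa using summable_pow_mul_geometric_of_norm_lt_one 1 hq
  refine Summable.of_norm_bounded
    (((h₁.mul_left α).add (h₀.mul_left β)).mul_left (M ^ β * Real.exp (-M))⁻¹) fun k => ?_
  have hs : 0 < α * k + β := by positivity
  have hΓ := Real.Gamma_pos_of_pos hs
  have hle := Real.rpow_mul_exp_neg_le_Gamma_add_one hs.le hM.le
  rw [Real.Gamma_add_one hs.ne', Real.rpow_add hM, Real.rpow_mul hM.le, hMα,
    Real.rpow_natCast] at hle
  rw [norm_div, norm_pow, Real.norm_eq_abs, Real.norm_of_nonneg hΓ.le]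
  have hc : 0 < M ^ β * Real.exp (-M) := by positivity
  calc |x| ^ k / Real.Gamma (α * k + β)
      ≤ |x| ^ k * ((α * k + β) / ((|x| + 1) ^ k * (M ^ β * Real.exp (-M)))) := by
        rw [div_eq_mul_inv]
        gcongr
        rw [inv_le_comm₀ hΓ (by positivity), inv_div, div_le_iff₀ hs]
        linarith
    _ = (M ^ β * Real.exp (-M))⁻¹ * (α * (k * q ^ k) + β * q ^ k) := by
        simp only [q, div_pow]
        field_simp

/-- The powers of a 2 × 2 Jordan block. -/
theorem jordanBlock_pow (lam : ℝ) (k : ℕ) :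
    (!![lam, 1; 0, lam] : Matrix (Fin 2) (Fin 2) ℝ) ^ k =
      !![lam ^ k, k * lam ^ (k - 1); 0, lam ^ k] := by
  induction k with
  | zero => simp [Matrix.one_fin_two]
  | succ k ih =>
    rw [pow_succ, ih, Matrix.mul_fin_two]
    rcases k with _ | k
    · simp
    · simp only [Nat.add_sub_cancel]
      push_cast
      congr! 4 <;> ring_nf

/-- For `α > 0`, `λ ∈ ℝ`, `t ≥ 0` and the Jordan block
`A = !![λ, 1; 0, λ]`, the matrix `E_α(t^α A)` is upper triangular with diagonal
entries `E_α(λ t^α)` and upper-right entry `(t^α / α) E_{α,α}(λ t^α)`. -/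
theorem matrixML_jordan_block (α lam t : ℝ) (hα : 0 < α) (ht : 0 ≤ t) :
    matrixML α ((t ^ α) • (!![lam, 1; 0, lam] : Matrix (Fin 2) (Fin 2) ℝ)) =
      !![realML α (lam * t ^ α), (t ^ α / α) * realML2 α α (lam * t ^ α);
         0, realML α (lam * t ^ α)] := by
  set T := t ^ α
  have hdiag : HasSum (fun k : ℕ => (Real.Gamma (α * k + 1))⁻¹ * (T ^ k * lam ^ k))
      (realML α (lam * T)) := by
    refine (summable_pow_div_Gamma hα one_pos (lam * T)).hasSum.congr_fun fun k => ?_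
    rw [mul_pow]
    ring
  have hoff : HasSum (fun k : ℕ => (Real.Gamma (α * k + 1))⁻¹ * (T ^ k * (k * lam ^ (k - 1))))
      (T / α * realML2 α α (lam * T)) := by
    rw [← hasSum_nat_add_iff' 1]
    simp only [Finset.range_one, Finset.sum_singleton, Nat.cast_zero, zero_mul, mul_zero, sub_zero]
    refine ((summable_pow_div_Gamma hα hα (lam * T)).hasSum.mul_left (T / α)).congr_fun fun k => ?_
    have hs : 0 < α * k + α := by positivity
    have hΓ := Real.Gamma_pos_of_pos hs
    rw [Nat.cast_add, Nat.cast_one, mul_add, mul_one, Real.Gamma_add_one hs.ne',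
      Nat.add_sub_cancel, mul_pow]
    field_simp
    ring
  refine HasSum.tsum_eq (Pi.hasSum.mpr fun i => Pi.hasSum.mpr fun j => ?_)
  simp only [smul_pow, jordanBlock_pow]
  fin_cases i <;> fin_cases j
  · simpa using hdiag
  · simpa using hoff
  · simp
  · simpa using hdiag
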